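/- Every countable strongly annihilated ideal I of a reduced commutative ring R is an ℵ₀-z°-ideal; that is, for every countable subset S ⊆ I, the intersection of all minimal prime ideals of R containing S is contained in I. -/

import Mathlib

/-- An ideal `I` is countable strongly annihilated if for each countable subset `S ⊆ I`
and each `b ∉ I` there exists `c` with `c * a = 0` for all `a ∈ S` but `c * b ≠ 0`. -/
def CountableStronglyAnnihilated {R : Type*} [CommRing R] (I : Ideal R) : Prop :=
  ∀ S : Set R, S.Countable → S ⊆ I → ∀ b ∉ I, ∃ c : R, (∀ a ∈ S, c * a = 0) ∧ c * b ≠ 0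

/-- In a reduced ring, every countable strongly annihilated ideal is an `ℵ₀-z°`-ideal:
for every countable `S ⊆ I`, the intersection of all minimal primes containing `S`
is contained in `I`. -/
theorem stmt8 {R : Type*} [CommRing R] [IsReduced R] (I : Ideal R)
    (hI : CountableStronglyAnnihilated I) :
    ∀ S : Set R, S.Countable → S ⊆ I → ∀ b : R,
      (∀ P ∈ minimalPrimes R, S ⊆ P → b ∈ P) → b ∈ I := by
  intro S hS hSI b hb
  by_contra hbI
  obtain ⟨c, hc, hcb⟩ := hI S hS hSI b hbI
  apply hcb
  have key : c * b ∈ sInf ((⊥ : Ideal R).minimalPrimes) := by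
    rw [Submodule.mem_sInf]
    intro (P : Ideal R) hP
    have hPp : P.IsPrime := hP.1.1
    by_cases hcP : c ∈ P
    · exact P.mul_mem_right b hcP
    · refine P.mul_mem_left c (hb P hP fun a ha => ?_)
      have h0 : c * a ∈ P := by
        rw [hc a ha]
        exact P.zero_mem
      exact (hPp.mem_or_mem h0).resolve_left hcP
  rw [Ideal.sInf_minimalPrimes] at key
  obtain ⟨n, hn⟩ := key
  exact IsReduced.eq_zero _ ⟨n, (Submodule.mem_bot R).1 hn⟩
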